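/- Let S be a finite conformal iterated function system with limit set Λ, ψ a Hölder continuous potential on Σ_I^+ with equilibrium measure μ^+, μ̂ the equilibrium measure of ψ∘π_1 for the skew product Φ, and {μ_ω} the conditional measures of μ̂ on the fibers {ω}×Λ. Then there exists a constant C > 0 such that for all Borel sets A_1 ⊂ Σ_I^+ and A_2 ⊂ Λ and μ^+-a.e. ω ∈ Σ_I^+, (1/C)·μ^+(A_1)·μ_ω(A_2) ≤ μ̂(A_1 × A_2) ≤ C·μ^+(A_1)·μ_ω(A_2). -/

import Mathlib

open MeasureTheory Set Filter Metric
open scoped NNReal ENNReal Topology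

noncomputable section

/-- Euclidean space `ℝ^D`. -/
abbrev EucSp (D : ℕ) := EuclideanSpace ℝ (Fin D)

/-- The one-sided symbolic space `Σ_m^+` on `m` symbols. -/
abbrev SymbSp (m : ℕ) := ℕ → Fin m

/-- The one-sided shift `σ`. -/
def shift {m : ℕ} : SymbSp m → SymbSp m := fun ω n => ω (n + 1)

/-- The word `ω_1 … ω_n` of the first `n` symbols of `ω`. -/
def word {m : ℕ} (ω : SymbSp m) (n : ℕ) : List (Fin m) := (List.range n).map ω

/-- The cylinder `[w_1 … w_n]` on a finite word `w`. -/
def cyl {m : ℕ} (w : List (Fin m)) : Set (SymbSp m) := {ω | word ω w.length = w}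

/-- The composition `φ_{i_1 … i_p} := φ_{i_1} ∘ … ∘ φ_{i_p}`. -/
def compWord {D m : ℕ} (φ : Fin m → EucSp D → EucSp D) : List (Fin m) → EucSp D → EucSp D
  | [] => id
  | i :: w => φ i ∘ compWord φ w

/-- Birkhoff sum `S_n ψ` with respect to the shift. -/
def birk {m : ℕ} (ψ : SymbSp m → ℝ) (n : ℕ) (ω : SymbSp m) : ℝ :=
  ∑ k ∈ Finset.range n, ψ (shift^[k] ω)

/-- Hölder continuity of a potential on the shift space (variation on cylinders
decays geometrically). -/
def HolderPotential {m : ℕ} (ψ : SymbSp m → ℝ) : Prop :=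
  ∃ C > (0 : ℝ), ∃ θ ∈ Ioo (0 : ℝ) 1, ∀ (n : ℕ) (ω η : SymbSp m),
    word ω n = word η n → |ψ ω - ψ η| ≤ C * θ ^ n

/-- The Gibbs property of a measure `μ` for the potential `ψ` with pressure `P`. -/
def IsGibbs {m : ℕ} (ψ : SymbSp m → ℝ) (P : ℝ) (μ : Measure (SymbSp m)) : Prop :=
  ∃ C : ℝ, 1 ≤ C ∧ ∀ (ω : SymbSp m) (n : ℕ),
    C⁻¹ * Real.exp (birk ψ n ω - n * P) ≤ (μ (cyl (word ω n))).toReal ∧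
    (μ (cyl (word ω n))).toReal ≤ C * Real.exp (birk ψ n ω - n * P)

/-- `μ` is the equilibrium (Gibbs) measure of the Hölder potential `ψ` for the
shift, with pressure `P`: it is a shift-invariant probability measure with the
Gibbs property; its entropy then satisfies `h(μ) = P - ∫ ψ dμ`. -/
def IsEquilibrium {m : ℕ} (ψ : SymbSp m → ℝ) (P : ℝ) (μ : Measure (SymbSp m)) : Prop :=
  IsProbabilityMeasure μ ∧ μ.map shift = μ ∧ IsGibbs ψ P μ

/-- A finite conformal iterated function system of injective contractions of a
compact set `V ⊂ ℝ^D` with nonempty interior. -/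
structure CIFS (D m : ℕ) where
  V : Set (EucSp D)
  φ : Fin m → EucSp D → EucSp D
  compactV : IsCompact V
  interiorV : (interior V).Nonempty
  mapsToV : ∀ i, MapsTo (φ i) V V
  injOnV : ∀ i, InjOn (φ i) V
  contraction : ∀ i, ∃ r : ℝ≥0, r < 1 ∧ LipschitzOnWith r (φ i) V
  conformal : ∀ i, ∀ x ∈ V, ConformalAt (φ i) x
  measurable_φ : ∀ i, Measurable (φ i)

/-- The limit set `Λ = ⋃_ω ⋂_n φ_{ω_1…ω_n}(V)`. -/
def CIFS.limitSet {D m : ℕ} (S : CIFS D m) : Set (EucSp D) :=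
  ⋃ ω : SymbSp m, ⋂ n : ℕ, compWord S.φ (word ω n) '' S.V

/-- `π` is the canonical coding map: `π(ω) ∈ φ_{ω_1…ω_n}(V)` for every `n`. -/
def CIFS.IsCoding {D m : ℕ} (S : CIFS D m) (π : SymbSp m → EucSp D) : Prop :=
  ∀ (ω : SymbSp m) (n : ℕ), π ω ∈ compWord S.φ (word ω n) '' S.V

/-- The skew product `Φ(ω,x) = (σω, φ_{ω_1}(x))`. -/
def skew {D m : ℕ} (S : CIFS D m) : SymbSp m × EucSp D → SymbSp m × EucSp D :=
  fun p => (shift p.1, S.φ (p.1 0) p.2)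

/-- `μ̂` is the equilibrium measure of `ψ ∘ π_1` for the skew product `Φ`, lifting
the equilibrium measure `μ⁺` of `ψ`: it is the unique `Φ`-invariant probability
measure on `Σ_m^+ × Λ` with `(π_1)_* μ̂ = μ⁺` (uniqueness holds since `Φ`
contracts the fibers). -/
def CIFS.IsLift {D m : ℕ} (S : CIFS D m) (μplus : Measure (SymbSp m))
    (μhat : Measure (SymbSp m × EucSp D)) : Prop :=
  IsProbabilityMeasure μhat ∧ μhat.map (skew S) = μhat ∧
    μhat.map Prod.fst = μplus ∧ μhat {p | p.2 ∈ S.limitSet}ᶜ = 0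

/-- Parry's Jacobian `J_T(μ)` of a measure `μ` under `T`: `μ(T(A)) = ∫_A J dμ` for
every measurable set `A` on which `T` is injective. The folding entropy is
`F_T(μ) = ∫ log J_T(μ) dμ` and the overlap number is `o = exp (F_T(μ))`. -/
def IsJacobianOf {α : Type*} [MeasurableSpace α] (T : α → α) (μ : Measure α)
    (J : α → ℝ) : Prop :=
  Measurable J ∧ ∀ A : Set α, MeasurableSet A → InjOn T A →
    μ (T '' A) = ENNReal.ofReal (∫ x in A, J x ∂μ)

/-- The stable Lyapunov exponent `χ_s(μ̂) = ∫ log |φ'_{ω_1}(x)| dμ̂(ω,x)`, where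
`|φ'_i(x)|` is the conformal derivative norm `‖(Dφ_i)_x‖`. -/
def CIFS.chiS {D m : ℕ} (S : CIFS D m) (μhat : Measure (SymbSp m × EucSp D)) : ℝ :=
  ∫ p : SymbSp m × EucSp D, Real.log ‖fderiv ℝ (S.φ (p.1 0)) p.2‖ ∂μhat

/-- The Hausdorff dimension `HD(ν)` of a measure: the infimum of the Hausdorff
dimensions of sets of full `ν`-measure. -/
def measDimH {X : Type*} [EMetricSpace X] [MeasurableSpace X] (ν : Measure X) : ℝ≥0∞ :=
  ⨅ (A : Set X) (_ : ν Aᶜ = 0), dimH A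

/-- `ν` is exact dimensional with pointwise dimension `d`: for `ν`-a.e. `x`,
`lim_{r→0} log ν(B(x,r)) / log r = d`. -/
def exactDimensionalWith {X : Type*} [PseudoMetricSpace X] [MeasurableSpace X]
    (ν : Measure X) (d : ℝ) : Prop :=
  ∀ᵐ x ∂ν, Tendsto (fun r : ℝ => Real.log (ν (Metric.ball x r)).toReal / Real.log r)
    (𝓝[>] (0 : ℝ)) (𝓝 d)

/-- `κ` is the system of Rokhlin conditional measures `{μ_ω}` of `μ̂` with respect
to the partition into fibers `{ω} × Λ` of `π_1`, viewed as measures on `Λ ⊆ ℝ^D`: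
for `μ⁺`-a.e. `ω` and every Borel `A`,
`μ_ω(A) = lim_n μ̂([ω_1…ω_n] × A) / μ⁺([ω_1…ω_n])`. -/
def IsCondSystem {D m : ℕ} (μplus : Measure (SymbSp m))
    (μhat : Measure (SymbSp m × EucSp D)) (κ : SymbSp m → Measure (EucSp D)) : Prop :=
  ∀ᵐ ω ∂μplus, ∀ A : Set (EucSp D), MeasurableSet A →
    Tendsto (fun n : ℕ => μhat (cyl (word ω n) ×ˢ A) / μplus (cyl (word ω n)))
      atTop (𝓝 (κ ω A))

section Comparison

variable {D m : ℕ}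

lemma mem_cyl_word {ω ζ : SymbSp m} {n : ℕ} :
    ζ ∈ cyl (word ω n) ↔ ∀ i < n, ζ i = ω i := by
  simp [cyl, word]

lemma shift_iterate_apply (n : ℕ) (ω : SymbSp m) (i : ℕ) : shift^[n] ω i = ω (i + n) := by
  induction n generalizing ω with
  | zero => rfl
  | succ n ih => rw [Function.iterate_succ_apply, ih, shift]; congr 1

lemma measurable_shift : Measurable (shift : SymbSp m → SymbSp m) :=
  measurable_pi_lambda _ fun n => measurable_pi_apply (n + 1)

lemma measurableSet_cyl_word (ω : SymbSp m) (n : ℕ) : MeasurableSet (cyl (word ω n)) := by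
  have h : cyl (word ω n) = ⋂ i ∈ Finset.range n, (fun ζ : SymbSp m => ζ i) ⁻¹' {ω i} := by
    ext ζ; simp [mem_cyl_word]
  rw [h]
  exact Finset.measurableSet_biInter _ fun i _ => measurable_pi_apply i (measurableSet_singleton _)

lemma birk_add (ψ : SymbSp m → ℝ) (n k : ℕ) (ω : SymbSp m) :
    birk ψ (n + k) ω = birk ψ n ω + birk ψ k (shift^[n] ω) := by
  simp only [birk, ← Function.iterate_add_apply]
  rw [Finset.sum_range_add]
  simp only [add_comm n]

/-- Membership in `W` is decided by the first `n` symbols. -/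
def DependsOnFirst (n : ℕ) (W : Set (SymbSp m)) : Prop :=
  ∀ ω ζ : SymbSp m, (∀ i < n, ζ i = ω i) → ω ∈ W → ζ ∈ W

lemma DependsOnFirst.preimage_image {n : ℕ} {W : Set (SymbSp m)} (hW : DependsOnFirst n W) :
    (fun (ω : SymbSp m) (i : Fin n) => ω i) ⁻¹' ((fun (ω : SymbSp m) (i : Fin n) => ω i) '' W)
      = W := by
  refine Subset.antisymm ?_ (subset_preimage_image _ _)
  rintro ζ ⟨ω, hω, h⟩
  exact hW ω ζ (fun i hi => (congrFun h ⟨i, hi⟩).symm) hω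

lemma measurable_initialSegment (n : ℕ) : Measurable (fun (ω : SymbSp m) (i : Fin n) => ω i) :=
  measurable_pi_lambda _ fun i => measurable_pi_apply (i : ℕ)

lemma DependsOnFirst.measurableSet {n : ℕ} {W : Set (SymbSp m)} (hW : DependsOnFirst n W) :
    MeasurableSet W := by
  rw [← hW.preimage_image]
  exact measurable_initialSegment n (Set.toFinite _).measurableSet

/-- Domination on cylinders of length `n` passes to unions of such cylinders. -/
lemma DependsOnFirst.measure_le {n : ℕ} {W : Set (SymbSp m)} (hW : DependsOnFirst n W)
    {ρ₁ ρ₂ : Measure (SymbSp m)} (h : ∀ ω, ρ₁ (cyl (word ω n)) ≤ ρ₂ (cyl (word ω n))) :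
    ρ₁ W ≤ ρ₂ W := by
  set f := fun (ω : SymbSp m) (i : Fin n) => ω i
  have hf : ∀ y, MeasurableSet (f ⁻¹' {y}) := fun y =>
    measurable_initialSegment n (measurableSet_singleton y)
  have key : W = f ⁻¹' ((Set.toFinite (f '' W)).toFinset : Set (Fin n → Fin m)) := by
    rw [Set.Finite.coe_toFinset, hW.preimage_image]
  rw [key, ← sum_measure_preimage_singleton _ fun y _ => hf y,
    ← sum_measure_preimage_singleton _ fun y _ => hf y]
  refine Finset.sum_le_sum fun y hy => ?_
  obtain ⟨ω, -, rfl⟩ := (Set.Finite.mem_toFinset _).1 hy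
  have : f ⁻¹' {f ω} = cyl (word ω n) := by
    ext ζ
    simp only [mem_preimage, mem_singleton_iff, mem_cyl_word, f, funext_iff, Fin.forall_iff]
  rw [this]
  exact h ω

/-- Domination of finite Borel measures can be tested on closed sets and their thickenings. -/
lemma measure_le_of_cthickening {X : Type*} [PseudoMetricSpace X] [MeasurableSpace X]
    [BorelSpace X] {a b : Measure X} [IsFiniteMeasure a] [IsFiniteMeasure b]
    (h : ∀ F : Set X, IsClosed F → ∀ δ > 0, a F ≤ b (cthickening δ F)) : a ≤ b := by
  refine Measure.le_iff.2 fun A hA => ?_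
  rw [hA.measure_eq_iSup_isClosed_of_ne_top (measure_ne_top a A)]
  refine iSup₂_le fun F hFA => iSup_le fun hF => le_trans ?_ (measure_mono hFA)
  have ht := tendsto_measure_cthickening_of_isClosed (μ := b)
    ⟨1, one_pos, measure_ne_top b _⟩ hF
  refine ge_of_tendsto (ht.mono_left (nhdsWithin_le_nhds (s := Ioi 0))) ?_
  filter_upwards [self_mem_nhdsWithin] with δ hδ using h F hF δ hδ

/-- Domination of finite Borel measures on the symbolic space can be tested on cylinders. -/
lemma measure_le_of_cyl {ρ₁ ρ₂ : Measure (SymbSp m)} [IsFiniteMeasure ρ₁] [IsFiniteMeasure ρ₂]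
    (h : ∀ ω n, ρ₁ (cyl (word ω n)) ≤ ρ₂ (cyl (word ω n))) : ρ₁ ≤ ρ₂ := by
  refine Measure.le_iff.2 fun A hA => ?_
  rw [hA.measure_eq_iSup_isClosed_of_ne_top (measure_ne_top ρ₁ A)]
  refine iSup₂_le fun F hFA => iSup_le fun hF => le_trans ?_ (measure_mono hFA)
  let U : ℕ → Set (SymbSp m) := fun n => {ζ | ∃ ω ∈ F, ∀ i < n, ζ i = ω i}
  have hU : ∀ n, DependsOnFirst n (U n) := by
    rintro n ω ζ h ⟨η, hη, h'⟩
    exact ⟨η, hη, fun i hi => (h i hi).trans (h' i hi)⟩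
  have hanti : Antitone U := by
    rintro n k hnk ζ ⟨η, hη, h'⟩
    exact ⟨η, hη, fun i hi => h' i (hi.trans_le hnk)⟩
  have hinter : ⋂ n, U n ⊆ F := by
    intro ζ hζ
    choose η hηF hη using fun n => mem_iInter.1 hζ n
    refine hF.mem_of_tendsto (b := atTop) (f := η) (tendsto_pi_nhds.2 fun i => ?_)
      (Eventually.of_forall hηF)
    refine tendsto_const_nhds.congr' ?_
    filter_upwards [eventually_gt_atTop i] with n hn using hη n i hn
  have ht := tendsto_measure_iInter_atTop (μ := ρ₂)
    (fun n => (hU n).measurableSet.nullMeasurableSet) hanti ⟨0, measure_ne_top ρ₂ _⟩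
  refine (ge_of_tendsto' ht fun n => ?_).trans (measure_mono hinter)
  exact (measure_mono (t := U n) fun ζ hζ => ⟨ζ, hζ, fun _ _ => rfl⟩).trans
    ((hU n).measure_le fun ω => h ω n)

/-- The sequence which follows `ω` for `n` symbols and then continues with `η`. -/
def concat (n : ℕ) (ω η : SymbSp m) : SymbSp m := fun i => if i < n then ω i else η (i - n)

lemma shift_iterate_concat (n : ℕ) (ω η : SymbSp m) : shift^[n] (concat n ω η) = η := by
  ext i
  simp [shift_iterate_apply, concat]

lemma cyl_word_concat (n : ℕ) (ω η : SymbSp m) :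
    cyl (word (concat n ω η) n) = cyl (word ω n) := by
  ext ζ
  simp only [mem_cyl_word, concat]
  exact forall₂_congr fun i hi => by rw [if_pos hi]

lemma cyl_word_concat_add (n k : ℕ) (ω η : SymbSp m) :
    cyl (word (concat n ω η) (n + k)) = cyl (word ω n) ∩ shift^[n] ⁻¹' cyl (word η k) := by
  ext ζ
  simp only [mem_inter_iff, mem_preimage, mem_cyl_word, shift_iterate_apply, concat]
  refine ⟨fun h => ⟨fun i hi => by simpa [hi] using h i (by omega), fun i hi => by
    simpa using h (i + n) (by omega)⟩, fun h i hi => ?_⟩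
  split_ifs with hin
  · exact h.1 i hin
  · simpa [Nat.sub_add_cancel (not_lt.1 hin)] using h.2 (i - n) (by omega)

/-- Gibbs measures are quasi-Bernoulli. -/
lemma IsGibbs.quasiBernoulli {ψ : SymbSp m → ℝ} {P : ℝ} {μ : Measure (SymbSp m)}
    [IsFiniteMeasure μ] (h : IsGibbs ψ P μ) :
    ∃ K : ℝ≥0, 0 < K ∧ ∀ (ω η : SymbSp m) (n k : ℕ),
      μ (cyl (word ω n) ∩ shift^[n] ⁻¹' cyl (word η k))
        ≤ K * (μ (cyl (word η k)) * μ (cyl (word ω n))) ∧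
      μ (cyl (word η k)) * μ (cyl (word ω n))
        ≤ K * μ (cyl (word ω n) ∩ shift^[n] ⁻¹' cyl (word η k)) := by
  obtain ⟨C, hC, hG⟩ := h
  have hC0 : 0 < C := by linarith
  refine ⟨⟨C ^ 3, by positivity⟩, by exact_mod_cast pow_pos hC0 3, fun ω η n k => ?_⟩
  obtain ⟨l₁, u₁⟩ := hG (concat n ω η) n
  obtain ⟨l₂, u₂⟩ := hG (shift^[n] (concat n ω η)) k
  obtain ⟨l₃, u₃⟩ := hG (concat n ω η) (n + k)
  have he : Real.exp (birk ψ (n + k) (concat n ω η) - ((n + k : ℕ) : ℝ) * P)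
      = Real.exp (birk ψ n (concat n ω η) - n * P)
        * Real.exp (birk ψ k (shift^[n] (concat n ω η)) - k * P) := by
    rw [birk_add, ← Real.exp_add]; push_cast; congr 1; ring
  rw [he] at l₃ u₃
  rw [shift_iterate_concat] at l₂ u₂ l₃ u₃
  rw [cyl_word_concat] at l₁ u₁
  rw [cyl_word_concat_add] at l₃ u₃
  set x := Real.exp (birk ψ n (concat n ω η) - n * P)
  set y := Real.exp (birk ψ k η - k * P)
  have hx : 0 < x := Real.exp_pos _
  have hy : 0 < y := Real.exp_pos _
  set a := cyl (word ω n)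
  set b := cyl (word η k)
  set c := a ∩ shift^[n] ⁻¹' b
  rw [inv_mul_le_iff₀ hC0] at l₁ l₂ l₃
  have ha : 0 ≤ (μ a).toReal := ENNReal.toReal_nonneg
  have hb : 0 ≤ (μ b).toReal := ENNReal.toReal_nonneg
  constructor
  · rw [← ENNReal.toReal_le_toReal (measure_ne_top _ _) (by finiteness), ENNReal.toReal_mul,
      ENNReal.toReal_mul]
    calc (μ c).toReal ≤ C * (x * y) := u₃
      _ ≤ C * ((C * (μ a).toReal) * (C * (μ b).toReal)) := by gcongr
      _ = C ^ 3 * ((μ b).toReal * (μ a).toReal) := by ring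
  · rw [← ENNReal.toReal_le_toReal (by finiteness) (by finiteness), ENNReal.toReal_mul,
      ENNReal.toReal_mul]
    calc (μ b).toReal * (μ a).toReal ≤ (C * y) * (C * x) := by gcongr
      _ = C ^ 2 * (x * y) := by ring
      _ ≤ C ^ 2 * (C * (μ c).toReal) := by gcongr
      _ = C ^ 3 * (μ c).toReal := by ring

lemma skew_iterate_fst (S : CIFS D m) (n : ℕ) (p : SymbSp m × EucSp D) :
    ((skew S)^[n] p).1 = shift^[n] p.1 := by
  induction n generalizing p with
  | zero => rfl
  | succ n ih => rw [Function.iterate_succ_apply, ih, Function.iterate_succ_apply]; rfl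

lemma skew_iterate_snd_congr (S : CIFS D m) (n : ℕ) {ω ζ : SymbSp m} (h : ∀ i < n, ζ i = ω i)
    (x : EucSp D) : ((skew S)^[n] (ζ, x)).2 = ((skew S)^[n] (ω, x)).2 := by
  induction n generalizing ω ζ x with
  | zero => rfl
  | succ n ih =>
    simp only [Function.iterate_succ_apply, skew, h 0 n.succ_pos]
    exact ih (fun i hi => h (i + 1) (by omega)) _

lemma CIFS.exists_uniform_contraction (S : CIFS D m) : ∃ r : ℝ≥0, r < 1 ∧
    ∀ i, LipschitzOnWith r (S.φ i) S.V := by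
  choose r hr hL using S.contraction
  exact ⟨Finset.univ.sup r, (Finset.sup_lt_iff (by simp)).2 fun i _ => hr i,
    fun i => (hL i).weaken (Finset.le_sup (Finset.mem_univ i))⟩

lemma dist_skew_iterate_snd_le (S : CIFS D m) {r : ℝ≥0}
    (hr : ∀ i, LipschitzOnWith r (S.φ i) S.V) (n : ℕ) (ω : SymbSp m) {x y : EucSp D}
    (hx : x ∈ S.V) (hy : y ∈ S.V) :
    dist ((skew S)^[n] (ω, x)).2 ((skew S)^[n] (ω, y)).2 ≤ r ^ n * dist x y := by
  induction n generalizing ω x y with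
  | zero => simp
  | succ n ih =>
    simp only [Function.iterate_succ_apply, skew]
    calc _ ≤ (r : ℝ) ^ n * dist (S.φ (ω 0) x) (S.φ (ω 0) y) :=
          ih _ (S.mapsToV _ hx) (S.mapsToV _ hy)
      _ ≤ (r : ℝ) ^ n * (r * dist x y) := by gcongr; exact (hr _).dist_le_mul _ hx _ hy
      _ = (r : ℝ) ^ (n + 1) * dist x y := by ring

lemma CIFS.exists_skew_iterate_close (S : CIFS D m) {x₀ : EucSp D} (hx₀ : x₀ ∈ S.V) {δ : ℝ}
    (hδ : 0 < δ) : ∃ n, ∀ ω : SymbSp m, ∀ x ∈ S.V,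
      dist ((skew S)^[n] (ω, x)).2 ((skew S)^[n] (ω, x₀)).2 ≤ δ := by
  obtain ⟨r, hr1, hr⟩ := S.exists_uniform_contraction
  obtain ⟨B, hB⟩ := S.compactV.isBounded.subset_closedBall x₀
  have hlim : Tendsto (fun n : ℕ => (r : ℝ) ^ n * B) atTop (𝓝 0) := by
    simpa using (tendsto_pow_atTop_nhds_zero_of_lt_one r.2
      (show (r : ℝ) < 1 by exact_mod_cast hr1)).mul_const B
  obtain ⟨n, hn⟩ := (hlim.eventually_le_const hδ).exists
  refine ⟨n, fun ω x hx => (dist_skew_iterate_snd_le S hr n ω hx hx₀).trans (le_trans ?_ hn)⟩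
  gcongr
  exact hB hx

lemma measurable_skew (S : CIFS D m) : Measurable (skew S) := by
  refine (measurable_shift.comp measurable_fst).prodMk ?_
  have h : Measurable fun q : Fin m × EucSp D => S.φ q.1 q.2 :=
    measurable_from_prod_countable_right S.measurable_φ
  have h0 : Measurable fun p : SymbSp m × EucSp D => (p.1 0, p.2) :=
    ((measurable_pi_apply 0).comp measurable_fst).prodMk measurable_snd
  exact h.comp h0

lemma CIFS.limitSet_subset (S : CIFS D m) : S.limitSet ⊆ S.V := by
  refine iUnion_subset fun ω x hx => ?_
  obtain ⟨y, hy, rfl⟩ := mem_iInter.1 hx 0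
  exact hy

/-- The measure `A ↦ μ̂(E × A)`. -/
def sliceMeasure (μhat : Measure (SymbSp m × EucSp D)) (E : Set (SymbSp m)) :
    Measure (EucSp D) :=
  (μhat.restrict (Prod.fst ⁻¹' E)).map Prod.snd

instance (μhat : Measure (SymbSp m × EucSp D)) [IsFiniteMeasure μhat] (E : Set (SymbSp m)) :
    IsFiniteMeasure (sliceMeasure μhat E) := by
  unfold sliceMeasure; infer_instance

lemma sliceMeasure_apply (μhat : Measure (SymbSp m × EucSp D)) (E : Set (SymbSp m))
    {A : Set (EucSp D)} (hA : MeasurableSet A) : sliceMeasure μhat E A = μhat (E ×ˢ A) := by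
  rw [sliceMeasure, Measure.map_apply measurable_snd hA,
    Measure.restrict_apply (measurable_snd hA), inter_comm]
  rfl

/-- The words along which the base point `x₀` is carried into `F`. -/
def landing (S : CIFS D m) (n : ℕ) (x₀ : EucSp D) (F : Set (EucSp D)) : Set (SymbSp m) :=
  {ω | ((skew S)^[n] (ω, x₀)).2 ∈ F}

lemma dependsOnFirst_landing (S : CIFS D m) (n : ℕ) (x₀ : EucSp D) (F : Set (EucSp D)) :
    DependsOnFirst n (landing S n x₀ F) := fun ω ζ h hω => by
  rw [landing, mem_ofPred_eq, skew_iterate_snd_congr S n h]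
  exact hω

section Lift

variable {S : CIFS D m} {μplus : Measure (SymbSp m)} {μhat : Measure (SymbSp m × EucSp D)}

lemma CIFS.IsLift.measure_fst (h : S.IsLift μplus μhat) {E : Set (SymbSp m)}
    (hE : MeasurableSet E) : μhat (Prod.fst ⁻¹' E) = μplus E := by
  rw [← h.2.2.1, Measure.map_apply measurable_fst hE]

lemma CIFS.IsLift.ae_mem (h : S.IsLift μplus μhat) : ∀ᵐ p ∂μhat, p.2 ∈ S.V :=
  measure_mono_null (fun _ hp hp' => hp (S.limitSet_subset hp')) h.2.2.2

lemma CIFS.IsLift.measure_preimage_iterate (h : S.IsLift μplus μhat) (n : ℕ)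
    {B : Set (SymbSp m × EucSp D)} (hB : MeasurableSet B) :
    μhat ((skew S)^[n] ⁻¹' B) = μhat B :=
  ((MeasurePreserving.mk (measurable_skew S) h.2.1).iterate n).measure_preimage
    hB.nullMeasurableSet

lemma CIFS.IsLift.measure_prod_le (h : S.IsLift μplus μhat) {x₀ : EucSp D} {n : ℕ} {δ : ℝ}
    (hn : ∀ ω : SymbSp m, ∀ x ∈ S.V,
      dist ((skew S)^[n] (ω, x)).2 ((skew S)^[n] (ω, x₀)).2 ≤ δ)
    {E : Set (SymbSp m)} (hE : MeasurableSet E) {F : Set (EucSp D)} (hF : MeasurableSet F) :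
    μhat (E ×ˢ F) ≤ μplus (landing S n x₀ (cthickening δ F) ∩ shift^[n] ⁻¹' E) := by
  rw [← h.measure_preimage_iterate n (hE.prod hF), ← h.measure_fst
    ((dependsOnFirst_landing S n x₀ _).measurableSet.inter ((measurable_shift.iterate n) hE))]
  refine measure_mono_ae ?_
  filter_upwards [h.ae_mem] with p hp hpE
  obtain ⟨h1, h2⟩ := hpE
  rw [skew_iterate_fst] at h1
  refine ⟨?_, h1⟩
  refine mem_cthickening_of_dist_le _ _ _ _ h2 ?_
  rw [dist_comm]
  exact hn p.1 p.2 hp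

lemma CIFS.IsLift.le_measure_prod (h : S.IsLift μplus μhat) {x₀ : EucSp D} {n : ℕ} {δ : ℝ}
    (hδ : 0 ≤ δ) (hn : ∀ ω : SymbSp m, ∀ x ∈ S.V,
      dist ((skew S)^[n] (ω, x)).2 ((skew S)^[n] (ω, x₀)).2 ≤ δ)
    {E : Set (SymbSp m)} (hE : MeasurableSet E) (F : Set (EucSp D)) :
    μplus (landing S n x₀ (cthickening δ F) ∩ shift^[n] ⁻¹' E)
      ≤ μhat (E ×ˢ cthickening (δ + δ) F) := by
  rw [← h.measure_preimage_iterate n (hE.prod isClosed_cthickening.measurableSet),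
    ← h.measure_fst
    ((dependsOnFirst_landing S n x₀ _).measurableSet.inter ((measurable_shift.iterate n) hE))]
  refine measure_mono_ae ?_
  filter_upwards [h.ae_mem] with p hp hpE
  obtain ⟨h1, h2⟩ := hpE
  refine ⟨by rw [skew_iterate_fst]; exact h2, ?_⟩
  exact cthickening_cthickening_subset hδ hδ F (mem_cthickening_of_dist_le _ _ _ _ h1
    (hn p.1 p.2 hp))

/-- The lift is comparable to the product of its marginals on sets `[v] × A`. -/
lemma CIFS.IsLift.exists_cyl_comparable (h : S.IsLift μplus μhat) {ψ : SymbSp m → ℝ} {P : ℝ}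
    (hμ : IsEquilibrium ψ P μplus) :
    ∃ K : ℝ≥0, 0 < K ∧ ∀ (η : SymbSp m) (k : ℕ) (A : Set (EucSp D)), MeasurableSet A →
      μhat (cyl (word η k) ×ˢ A) ≤ K * (μplus (cyl (word η k)) * μhat (univ ×ˢ A)) ∧
      μplus (cyl (word η k)) * μhat (univ ×ˢ A) ≤ K * μhat (cyl (word η k) ×ˢ A) := by
  have := hμ.1
  have := h.1
  obtain ⟨x₀, hx₀⟩ := S.interiorV
  replace hx₀ := interior_subset hx₀
  obtain ⟨K, hK, hqb⟩ := hμ.2.2.quasiBernoulli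
  refine ⟨K, hK, fun η k A hA => ?_⟩
  have hv := measurableSet_cyl_word η k
  set v := cyl (word η k)
  have hcyl : ∀ n, ∀ W, DependsOnFirst n W →
      μplus (W ∩ shift^[n] ⁻¹' v) ≤ K * (μplus v * μplus W) ∧
      μplus v * μplus W ≤ K * μplus (W ∩ shift^[n] ⁻¹' v) := by
    intro n W hW
    have hvn : MeasurableSet (shift^[n] ⁻¹' v) := measurable_shift.iterate n hv
    constructor
    · have := hW.measure_le (ρ₁ := μplus.restrict (shift^[n] ⁻¹' v))
        (ρ₂ := ((K : ℝ≥0∞) * μplus v) • μplus) fun ω => by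
          rw [Measure.restrict_apply' hvn, Measure.smul_apply, smul_eq_mul, mul_assoc]
          exact (hqb ω η n k).1
      rwa [Measure.restrict_apply' hvn, Measure.smul_apply, smul_eq_mul, mul_assoc] at this
    · have := hW.measure_le (ρ₁ := μplus v • μplus)
        (ρ₂ := (K : ℝ≥0∞) • μplus.restrict (shift^[n] ⁻¹' v)) fun ω => by
          rw [Measure.smul_apply, Measure.smul_apply, Measure.restrict_apply' hvn, smul_eq_mul,
            smul_eq_mul]
          exact (hqb ω η n k).2
      rwa [Measure.smul_apply, Measure.smul_apply, Measure.restrict_apply' hvn, smul_eq_mul,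
        smul_eq_mul] at this
  have hsplit : ∀ δ > 0, ∃ n, ∀ ω : SymbSp m, ∀ x ∈ S.V,
      dist ((skew S)^[n] (ω, x)).2 ((skew S)^[n] (ω, x₀)).2 ≤ δ / 2 := fun δ hδ =>
    S.exists_skew_iterate_close hx₀ (half_pos hδ)
  constructor
  · have hle : sliceMeasure μhat v ≤ (K * (μplus v).toNNReal) • sliceMeasure μhat univ := by
      refine measure_le_of_cthickening fun F hF δ hδ => ?_
      obtain ⟨n, hn⟩ := hsplit δ hδ
      rw [sliceMeasure_apply _ _ hF.measurableSet, Measure.smul_apply,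
        sliceMeasure_apply _ _ isClosed_cthickening.measurableSet, ENNReal.smul_def,
        ENNReal.coe_mul, ENNReal.coe_toNNReal (measure_ne_top _ _), smul_eq_mul, mul_assoc]
      refine (h.measure_prod_le hn hv hF.measurableSet).trans
        ((hcyl n _ (dependsOnFirst_landing S n x₀ _)).1.trans ?_)
      gcongr
      have := h.le_measure_prod (half_pos hδ).le hn MeasurableSet.univ F
      rwa [preimage_univ, inter_univ, add_halves] at this
    have := hle A
    rwa [sliceMeasure_apply _ _ hA, Measure.smul_apply, sliceMeasure_apply _ _ hA,
      ENNReal.smul_def, ENNReal.coe_mul, ENNReal.coe_toNNReal (measure_ne_top _ _), smul_eq_mul,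
      mul_assoc] at this
  · have hle : (μplus v).toNNReal • sliceMeasure μhat univ ≤ K • sliceMeasure μhat v := by
      refine measure_le_of_cthickening fun F hF δ hδ => ?_
      obtain ⟨n, hn⟩ := hsplit δ hδ
      rw [Measure.smul_apply, Measure.smul_apply, sliceMeasure_apply _ _ hF.measurableSet,
        sliceMeasure_apply _ _ isClosed_cthickening.measurableSet, ENNReal.smul_def,
        ENNReal.smul_def, ENNReal.coe_toNNReal (measure_ne_top _ _), smul_eq_mul, smul_eq_mul]
      have h1 := h.measure_prod_le hn MeasurableSet.univ hF.measurableSet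
      rw [preimage_univ, inter_univ] at h1
      have h2 := h.le_measure_prod (half_pos hδ).le hn hv F
      rw [add_halves] at h2
      calc μplus v * μhat (univ ×ˢ F)
          ≤ μplus v * μplus (landing S n x₀ (cthickening (δ / 2) F)) := by gcongr
        _ ≤ _ := (hcyl n _ (dependsOnFirst_landing S n x₀ _)).2
        _ ≤ _ := by gcongr
    have := hle A
    rwa [Measure.smul_apply, Measure.smul_apply, sliceMeasure_apply _ _ hA,
      sliceMeasure_apply _ _ hA, ENNReal.smul_def, ENNReal.smul_def,
      ENNReal.coe_toNNReal (measure_ne_top _ _), smul_eq_mul, smul_eq_mul] at this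

/-- The lift is comparable to the product of its marginals. -/
lemma CIFS.IsLift.exists_comparable (h : S.IsLift μplus μhat) {ψ : SymbSp m → ℝ} {P : ℝ}
    (hμ : IsEquilibrium ψ P μplus) :
    ∃ K : ℝ≥0, 0 < K ∧ ∀ E : Set (SymbSp m), MeasurableSet E →
      ∀ A : Set (EucSp D), MeasurableSet A →
      μhat (E ×ˢ A) ≤ K * (μplus E * μhat (univ ×ˢ A)) ∧
      μplus E * μhat (univ ×ˢ A) ≤ K * μhat (E ×ˢ A) := by
  have := hμ.1
  have := h.1
  obtain ⟨K, hK, hcyl⟩ := h.exists_cyl_comparable hμ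
  refine ⟨K, hK, fun E hE A hA => ?_⟩
  let ρ : Measure (SymbSp m) := (μhat.restrict (Prod.snd ⁻¹' A)).map Prod.fst
  have hρ : ∀ E, MeasurableSet E → ρ E = μhat (E ×ˢ A) := fun E hE => by
    rw [Measure.map_apply measurable_fst hE, Measure.restrict_apply (measurable_fst hE)]
    rfl
  constructor
  · have hle : ρ ≤ (K * (μhat (univ ×ˢ A)).toNNReal) • μplus := by
      refine measure_le_of_cyl fun ω n => ?_
      rw [hρ _ (measurableSet_cyl_word ω n), Measure.smul_apply, ENNReal.smul_def,
        ENNReal.coe_mul, ENNReal.coe_toNNReal (measure_ne_top _ _), smul_eq_mul, mul_assoc,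
        mul_comm (μhat _)]
      exact (hcyl ω n A hA).1
    have := hle E
    rwa [hρ _ hE, Measure.smul_apply, ENNReal.smul_def, ENNReal.coe_mul,
      ENNReal.coe_toNNReal (measure_ne_top _ _), smul_eq_mul, mul_assoc, mul_comm (μhat _)]
      at this
  · have hle : (μhat (univ ×ˢ A)).toNNReal • μplus ≤ K • ρ := by
      refine measure_le_of_cyl fun ω n => ?_
      rw [Measure.smul_apply, Measure.smul_apply, hρ _ (measurableSet_cyl_word ω n),
        ENNReal.smul_def, ENNReal.smul_def, ENNReal.coe_toNNReal (measure_ne_top _ _),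
        smul_eq_mul, smul_eq_mul, mul_comm (μhat _)]
      exact (hcyl ω n A hA).2
    have := hle E
    rwa [Measure.smul_apply, Measure.smul_apply, hρ _ hE,
        ENNReal.smul_def, ENNReal.smul_def, ENNReal.coe_toNNReal (measure_ne_top _ _),
        smul_eq_mul, smul_eq_mul, mul_comm (μhat _)] at this

end Lift

lemma IsGibbs.measure_cyl_ne_zero {ψ : SymbSp m → ℝ} {P : ℝ} {μ : Measure (SymbSp m)}
    (h : IsGibbs ψ P μ) (ω : SymbSp m) (n : ℕ) : μ (cyl (word ω n)) ≠ 0 := by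
  obtain ⟨C, hC, hG⟩ := h
  intro h0
  have := (hG ω n).1
  rw [h0, ENNReal.toReal_zero] at this
  have : 0 < C⁻¹ * Real.exp (birk ψ n ω - n * P) := by positivity
  linarith

end Comparison

/-- second part of Lemma 1 of the paper. There is `C > 0` such
that for all Borel `A₁ ⊆ Σ_I^+`, `A₂ ⊆ Λ` and `μ⁺`-a.e. `ω`,
`(1/C)·μ⁺(A₁)·μ_ω(A₂) ≤ μ̂(A₁ × A₂) ≤ C·μ⁺(A₁)·μ_ω(A₂)`. -/
theorem statement8 {D m : ℕ} (hD : 1 ≤ D) (hm : 1 ≤ m) (S : CIFS D m)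
    (ψ : SymbSp m → ℝ) (hψ : HolderPotential ψ) (P : ℝ)
    (μplus : Measure (SymbSp m)) (hμplus : IsEquilibrium ψ P μplus)
    (μhat : Measure (SymbSp m × EucSp D)) (hμhat : S.IsLift μplus μhat)
    (κ : SymbSp m → Measure (EucSp D)) (hκ : IsCondSystem μplus μhat κ) :
    ∃ C : ℝ≥0, 0 < C ∧
      ∀ A₁ : Set (SymbSp m), MeasurableSet A₁ →
      ∀ A₂ : Set (EucSp D), A₂ ⊆ S.limitSet → MeasurableSet A₂ →
      ∀ᵐ ω ∂μplus,
        (C : ℝ≥0∞)⁻¹ * (μplus A₁ * κ ω A₂) ≤ μhat (A₁ ×ˢ A₂) ∧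
        μhat (A₁ ×ˢ A₂) ≤ (C : ℝ≥0∞) * (μplus A₁ * κ ω A₂) := by
  have := hμplus.1
  have := hμhat.1
  obtain ⟨K, hK, hcomp⟩ := hμhat.exists_comparable hμplus
  refine ⟨K * K, mul_pos hK hK, fun A₁ hA₁ A₂ _ hA₂ => ?_⟩
  obtain ⟨h₁, h₂⟩ := hcomp A₁ hA₁ A₂ hA₂
  filter_upwards [hκ] with ω hω
  have hlim := hω A₂ hA₂
  have hpos := hμplus.2.2.measure_cyl_ne_zero ω
  have hκ_le : κ ω A₂ ≤ K * μhat (univ ×ˢ A₂) := le_of_tendsto' hlim fun n => by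
    refine ENNReal.div_le_of_le_mul ?_
    rw [mul_assoc, mul_comm (μhat _)]
    exact (hcomp _ (measurableSet_cyl_word ω n) A₂ hA₂).1
  have hle_κ : μhat (univ ×ˢ A₂) ≤ K * κ ω A₂ :=
    ge_of_tendsto' (ENNReal.Tendsto.const_mul hlim (.inr ENNReal.coe_ne_top)) fun n => by
      rw [← mul_div_assoc, ENNReal.le_div_iff_mul_le (.inl (hpos n))
        (.inl (measure_ne_top _ _)), mul_comm]
      exact (hcomp _ (measurableSet_cyl_word ω n) A₂ hA₂).2
  constructor
  · rw [mul_comm, ← div_eq_mul_inv]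
    refine ENNReal.div_le_of_le_mul ?_
    calc μplus A₁ * κ ω A₂ ≤ μplus A₁ * (K * μhat (univ ×ˢ A₂)) := by gcongr
      _ = K * (μplus A₁ * μhat (univ ×ˢ A₂)) := by ring
      _ ≤ K * (K * μhat (A₁ ×ˢ A₂)) := by gcongr
      _ = μhat (A₁ ×ˢ A₂) * ((K * K : ℝ≥0) : ℝ≥0∞) := by push_cast; ring
  · calc μhat (A₁ ×ˢ A₂) ≤ K * (μplus A₁ * μhat (univ ×ˢ A₂)) := h₁
      _ ≤ K * (μplus A₁ * (K * κ ω A₂)) := by gcongr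
      _ = ((K * K : ℝ≥0) : ℝ≥0∞) * (μplus A₁ * κ ω A₂) := by push_cast; ring
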